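/- Let τ be in the upper half plane ℍ. For every pair (x, y) ∈ ℂ × ℂ satisfying y² = 4x³ − g₂(τ)x − g₃(τ), there exists z ∈ ℂ \ L_τ with ℘_τ(z) = x and ℘′_τ(z) = y; i.e. the map z ↦ (℘_τ(z), ℘′_τ(z)) parametrizes all affine points of the elliptic curve y² = 4x³ − g₂(τ)x − g₃(τ). -/

import Mathlib

/-- A lattice point mτ + n of the lattice L_τ = ℤ + ℤτ, indexed by (m, n) ∈ ℤ × ℤ. -/
noncomputable def latPt (τ : ℂ) (p : ℤ × ℤ) : ℂ := (p.1 : ℂ) * τ + (p.2 : ℂ)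

/-- g₂(τ) = 60 Σ_{ω ∈ L_τ, ω ≠ 0} ω⁻⁴. -/
noncomputable def gTwo (τ : ℂ) : ℂ := 60 * ∑' p : {p : ℤ × ℤ // p ≠ 0}, 1 / latPt τ p.1 ^ 4

/-- g₃(τ) = 140 Σ_{ω ∈ L_τ, ω ≠ 0} ω⁻⁶. -/
noncomputable def gThree (τ : ℂ) : ℂ := 140 * ∑' p : {p : ℤ × ℤ // p ≠ 0}, 1 / latPt τ p.1 ^ 6

/-- The Weierstrass ℘-function
℘_τ(z) = 1/z² + Σ_{ω ∈ L_τ, ω ≠ 0} ( 1/(z−ω)² − 1/ω² ). -/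
noncomputable def wp (τ z : ℂ) : ℂ :=
  1 / z ^ 2 + ∑' p : {p : ℤ × ℤ // p ≠ 0}, (1 / (z - latPt τ p.1) ^ 2 - 1 / latPt τ p.1 ^ 2)

/-- The derivative ℘′_τ(z) = −2 Σ_{ω ∈ L_τ} 1/(z−ω)³. -/
noncomputable def wp' (τ z : ℂ) : ℂ := -2 * ∑' p : ℤ × ℤ, 1 / (z - latPt τ p) ^ 3

namespace PeriodPair

variable (L : PeriodPair)

open Classical in
/-- The function `1 / (℘ - x)`, extended by zero to the lattice. -/
noncomputable def invWeierstrassPSub (x z : ℂ) : ℂ :=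
  if z ∈ L.lattice then 0 else (L.weierstrassP z - x)⁻¹

lemma invWeierstrassPSub_add_coe (x z : ℂ) (l : L.lattice) :
    L.invWeierstrassPSub x (z + l) = L.invWeierstrassPSub x z := by
  have : z + l ∈ L.lattice ↔ z ∈ L.lattice := L.lattice.add_mem_iff_left l.2
  by_cases hz : z ∈ L.lattice <;> simp [invWeierstrassPSub, this, hz]

lemma differentiable_invWeierstrassPSub {x : ℂ} (hx : ∀ z ∉ L.lattice, L.weierstrassP z ≠ x) :
    Differentiable ℂ (L.invWeierstrassPSub x) := by
  intro w
  by_cases hw : w ∈ L.lattice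
  · have hP : DifferentiableAt ℂ (L.weierstrassPExcept w) w :=
      (L.analyticAt_weierstrassPExcept w).differentiableAt
    have hd : DifferentiableAt ℂ (fun z ↦ (z - w) ^ 2 /
        ((z - w) ^ 2 * L.weierstrassPExcept w z + 1 - (z - w) ^ 2 / w ^ 2 - x * (z - w) ^ 2)) w :=
      .fun_div (by fun_prop) (by fun_prop) (by simp)
    refine hd.congr_of_eventuallyEq ?_
    filter_upwards [L.compl_lattice_sdiff_singleton_mem_nhds w] with z hz
    rw [← L.ite_eq_one_sub_sq_mul_weierstrassP w hw z]
    by_cases hzw : z = w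
    · simp [hzw, invWeierstrassPSub, hw]
    · have hzL : z ∉ L.lattice := fun h ↦ hz ⟨h, hzw⟩
      have h₁ : z - w ≠ 0 := sub_ne_zero.mpr hzw
      have h₂ : L.weierstrassP z - x ≠ 0 := sub_ne_zero.mpr (hx z hzL)
      rw [invWeierstrassPSub, if_neg hzL, if_neg hzw, mul_comm x, ← mul_sub]
      field_simp
  · have hP : DifferentiableAt ℂ L.weierstrassP w :=
      (L.analyticOnNhd_weierstrassP w hw).differentiableAt
    refine ((hP.sub_const x).inv (sub_ne_zero.mpr (hx w hw))).congr_of_eventuallyEq ?_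
    filter_upwards [L.isClosed_lattice.isOpen_compl.mem_nhds hw] with z hz
    exact if_neg hz

/-- `℘` takes every complex value off the lattice. -/
lemma exists_weierstrassP_eq (x : ℂ) : ∃ z ∉ L.lattice, L.weierstrassP z = x := by
  by_contra! hx
  have hd := L.differentiable_invWeierstrassPSub hx
  have hbdd := (IsZLattice.isCompact_range_of_periodic L.lattice _ hd.continuous fun z w hw ↦
    L.invWeierstrassPSub_add_coe x z ⟨w, hw⟩).isBounded
  have h := hd.apply_eq_apply_of_bounded hbdd (L.ω₁ / 2) 0
  rw [invWeierstrassPSub, invWeierstrassPSub, if_neg L.ω₁_div_two_notMem_lattice,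
    if_pos L.lattice.zero_mem] at h
  exact inv_ne_zero (sub_ne_zero.mpr (hx _ L.ω₁_div_two_notMem_lattice)) h

/-- Every affine point of `y² = 4x³ - g₂x - g₃` is of the form `(℘ z, ℘' z)`. -/
lemma exists_weierstrassP_eq_and_derivWeierstrassP_eq {x y : ℂ}
    (hxy : y ^ 2 = 4 * x ^ 3 - L.g₂ * x - L.g₃) :
    ∃ z ∉ L.lattice, L.weierstrassP z = x ∧ L.derivWeierstrassP z = y := by
  obtain ⟨z, hz, rfl⟩ := L.exists_weierstrassP_eq x
  rw [← L.derivWeierstrassP_sq z hz, sq_eq_sq_iff_eq_or_eq_neg] at hxy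
  obtain rfl | rfl := hxy
  · exact ⟨z, hz, rfl, rfl⟩
  · exact ⟨-z, by simpa using hz, by simp, by simp⟩

/-- The period pair `(τ, 1)` for `τ` in the upper half plane. -/
def ofIm (τ : ℂ) (hτ : 0 < τ.im) : PeriodPair where
  ω₁ := τ
  ω₂ := 1
  indep := by
    refine LinearIndependent.pair_iff.mpr fun s t h ↦ ?_
    have him := congrArg Complex.im h
    have hs : s = 0 := by simpa [hτ.ne'] using him
    exact ⟨hs, by simpa [hs] using h⟩

section ofIm

variable (τ : ℂ) (hτ : 0 < τ.im)

lemma tsum_latPt {M : Type*} [AddCommMonoid M] [TopologicalSpace M] (f : ℂ → M) :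
    ∑' p : ℤ × ℤ, f (latPt τ p) = ∑' l : (ofIm τ hτ).lattice, f l := by
  rw [← (ofIm τ hτ).latticeEquivProd.symm.toEquiv.tsum_eq]
  refine tsum_congr fun p ↦ congrArg f ?_
  have h := (ofIm τ hτ).latticeEquiv_symm_apply p
  simp only [ofIm, mul_one] at h
  exact h.symm

lemma latPt_eq_zero_iff {τ : ℂ} (hτ : 0 < τ.im) (p : ℤ × ℤ) : latPt τ p = 0 ↔ p = 0 := by
  refine ⟨fun h ↦ ?_, by rintro rfl; simp [latPt]⟩
  have h₁ : p.1 = 0 := by simpa [latPt, hτ.ne'] using congrArg Complex.im h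
  have h₂ : p.2 = 0 := by simpa [latPt, h₁] using h
  exact Prod.ext h₁ h₂

lemma tsum_latPt_ne_zero (f : ℂ → ℂ) (hf : f 0 = 0) :
    ∑' p : {p : ℤ × ℤ // p ≠ 0}, f (latPt τ p) = ∑' l : (ofIm τ hτ).lattice, f l := by
  rw [← tsum_latPt]
  refine tsum_subtype_eq_of_support_subset (f := fun p ↦ f (latPt τ p)) (s := {p | p ≠ 0})
    fun p hp ↦ ?_
  rintro rfl
  exact hp (by simpa [latPt] using hf)

lemma gTwo_eq : gTwo τ = (ofIm τ hτ).g₂ := by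
  simp [gTwo, g₂, G, tsum_latPt_ne_zero τ hτ fun l ↦ (l ^ 4)⁻¹]

lemma gThree_eq : gThree τ = (ofIm τ hτ).g₃ := by
  simp [gThree, g₃, G, tsum_latPt_ne_zero τ hτ fun l ↦ (l ^ 6)⁻¹]

lemma wp_eq (z : ℂ) : wp τ z = (ofIm τ hτ).weierstrassP z := by
  have h := tsum_latPt_ne_zero τ hτ
    (fun l ↦ if l = 0 then 0 else 1 / (z - l) ^ 2 - 1 / l ^ 2) (if_pos rfl)
  have h₀ := (ofIm τ hτ).weierstrassPExcept_add 0 z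
  simp only [weierstrassPExcept, ZeroMemClass.coe_zero] at h₀
  rw [← h₀]
  simp only [ZeroMemClass.coe_eq_zero] at h ⊢
  rw [← h, wp, add_comm]
  congr 1
  · refine tsum_congr fun p ↦ (if_neg ?_).symm
    rw [latPt_eq_zero_iff hτ]
    exact p.2
  · simp

lemma wp'_eq (z : ℂ) : wp' τ z = (ofIm τ hτ).derivWeierstrassP z := by
  rw [wp', tsum_latPt τ hτ fun l ↦ 1 / (z - l) ^ 3, derivWeierstrassP, neg_mul, ← tsum_mul_left]
  simp [div_eq_mul_inv]

end ofIm

end PeriodPair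

/-- For τ in the upper half plane, every affine point (x, y) of the elliptic curve
y² = 4x³ − g₂(τ)x − g₃(τ) is of the form (℘_τ(z), ℘′_τ(z)) for some z ∈ ℂ \\ L_τ. -/
theorem wp_parametrizes_curve (τ : ℂ) (hτ : 0 < τ.im) (x y : ℂ)
    (hxy : y ^ 2 = 4 * x ^ 3 - gTwo τ * x - gThree τ) :
    ∃ z : ℂ, (∀ m n : ℤ, z ≠ (m : ℂ) * τ + (n : ℂ)) ∧ wp τ z = x ∧ wp' τ z = y := by
  rw [PeriodPair.gTwo_eq τ hτ, PeriodPair.gThree_eq τ hτ] at hxy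
  obtain ⟨z, hz, hx, hy⟩ :=
    (PeriodPair.ofIm τ hτ).exists_weierstrassP_eq_and_derivWeierstrassP_eq hxy
  refine ⟨z, fun m n h ↦ hz ?_, (PeriodPair.wp_eq τ hτ z).trans hx,
    (PeriodPair.wp'_eq τ hτ z).trans hy⟩
  exact PeriodPair.mem_lattice.mpr ⟨m, n, by simp [PeriodPair.ofIm, h]⟩
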